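/- Let n = 4 and let ω = (1/2)(dq¹∧dq²∧dq³∧dp₂ − dq¹∧dq²∧dq⁴∧dp₁ − dq²∧dq³∧dq⁴∧dp₃ + dq¹∧dq³∧dq⁴∧dp₄) + dq³∧dq⁴∧dp₁∧dp₂ on ℝ⁹. Then: (i) ω is effective and (j¹φ)*ω = (φ₁₁φ₂₂ − (φ₁₂)² + φ₁₃ + φ₂₄)·β for every smooth φ: ℝ⁴ → ℝ, where φ_{μν} := ∂²φ/∂q^μ∂q^ν, so ω represents the second heavenly equation of Plebański φ₁₁φ₂₂ − (φ₁₂)² + φ₁₃ + φ₂₄ = 0; and (ii) there exist no smooth function L: ℝ⁹ → ℝ and no nowhere-vanishing smooth function k: ℝ⁹ → ℝ such that k·ω = E(Lβ). Hence the second heavenly equation is not the Euler–Lagrange equation of any first-order Lagrangian. -/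

import Mathlib

noncomputable section

namespace MA

/-- Points / tangent vectors of ℝ^m. -/
abbrev Vec (m : ℕ) := Fin m → ℝ

/-- An (unbundled) differential `k`-form on ℝ^m : at each point it eats a
`k`-tuple of tangent vectors and returns a real number. -/
abbrev Form (m k : ℕ) := Vec m → (Fin k → Vec m) → ℝ

/-- `ω` is pointwise an alternating multilinear map, i.e. a genuine exterior form. -/
def IsForm {m k : ℕ} (ω : Form m k) : Prop :=
  ∀ x : Vec m, ∃ a : AlternatingMap ℝ (Vec m) ℝ (Fin k), ∀ v, ω x v = a v

/-- Smoothness of a differential form (smoothness of all coefficients). -/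
def SmoothForm {m k : ℕ} (ω : Form m k) : Prop :=
  ∀ v : Fin k → Vec m, ContDiff ℝ (⊤ : ℕ∞) fun x => ω x v

/-- Multiplication of a form by a scalar function. -/
def fsmul {m k : ℕ} (f : Vec m → ℝ) (ω : Form m k) : Form m k := fun x v => f x * ω x v

/-- Wedge (exterior) product of differential forms. -/
def wedge {m k l : ℕ} (ω : Form m k) (η : Form m l) : Form m (k + l) := fun x v =>
  ((k.factorial * l.factorial : ℕ) : ℝ)⁻¹ *
    ∑ σ : Equiv.Perm (Fin (k + l)),
      ((Equiv.Perm.sign σ : ℤ) : ℝ) *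
        (ω x fun i => v (σ (Fin.castAdd l i))) *
        (η x fun j => v (σ (Fin.natAdd k j)))

/-- Interior product (contraction) of a form with a (constant) vector. -/
def iprod {m : ℕ} (u : Vec m) : ∀ {k : ℕ}, Form m k → Form m (k - 1)
  | 0, _ => 0
  | _ + 1, ω => fun x v => ω x (Fin.cons u v)

/-- Exterior derivative of a differential form (coordinate formula). -/
def exd {m k : ℕ} (ω : Form m k) : Form m (k + 1) := fun x v =>
  ∑ i : Fin (k + 1),
    (-1 : ℝ) ^ (i : ℕ) * fderiv ℝ (fun y => ω y fun j => v (i.succAbove j)) x (v i)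

/-- Change the (propositionally equal) degree of a form. -/
def reindex {m k l : ℕ} (h : k = l) (ω : Form m k) : Form m l :=
  fun x v => ω x fun i => v (Fin.cast h i)

/-- Pullback of a differential form along a map. -/
def pullback {a b k : ℕ} (f : Vec a → Vec b) (ω : Form b k) : Form a k :=
  fun x v => ω (f x) fun i => fderiv ℝ f x (v i)

/-- `i`-th standard basis vector of ℝ^m. -/
def basisVec {m : ℕ} (i : Fin m) : Vec m := Pi.single i 1

/-- The coordinate 1-form `dx^i`. -/
def dx {m : ℕ} (i : Fin m) : Form m 1 := fun _ v => v 0 i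

/-- Partial derivative of a function in the `i`-th coordinate direction. -/
def pd {m : ℕ} (i : Fin m) (f : Vec m → ℝ) : Vec m → ℝ := fun x => fderiv ℝ f x (basisVec i)

/- Jet-space coordinates on J¹ℝⁿ = ℝ^{2n+1} : (q¹,…,qⁿ,u,p₁,…,pₙ). -/

/-- Index of the coordinate `q^μ`. -/
def qIdx {n : ℕ} (μ : Fin n) : Fin (2 * n + 1) := ⟨μ, by have := μ.isLt; omega⟩

/-- Index of the coordinate `u`. -/
def uIdx {n : ℕ} : Fin (2 * n + 1) := ⟨n, by omega⟩

/-- Index of the coordinate `p_μ`. -/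
def pIdx {n : ℕ} (μ : Fin n) : Fin (2 * n + 1) := ⟨n + 1 + μ, by have := μ.isLt; omega⟩

/-- The Reeb field `χ = ∂/∂u` (a constant vector field). -/
def chi {n : ℕ} : Vec (2 * n + 1) := basisVec uIdx

/-- The standard contact form `c = du - Σ p_μ dq^μ` on J¹ℝⁿ. -/
def contact {n : ℕ} : Form (2 * n + 1) 1 := fun x v =>
  v 0 uIdx - ∑ μ : Fin n, x (pIdx μ) * v 0 (qIdx μ)

/-- The symplectic-type 2-form `Ω = dc = Σ dq^μ ∧ dp_μ`. -/
def symp {n : ℕ} : Form (2 * n + 1) 2 := ∑ μ : Fin n, wedge (dx (qIdx μ)) (dx (pIdx μ))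

/-- The bottom operator `⊥ = Σ_μ ∂_{p_μ} ⌟ ∂_{q^μ} ⌟ ·` (zero on forms of degree ≤ 1). -/
def botOp {n k : ℕ} (ω : Form (2 * n + 1) k) : Form (2 * n + 1) (k - 2) :=
  ∑ μ : Fin n, iprod (basisVec (pIdx μ)) (iprod (basisVec (qIdx μ)) ω)

/-- A form is effective if it is killed by `χ ⌟ ·` and by `⊥`. -/
def Effective {n k : ℕ} (ω : Form (2 * n + 1) k) : Prop :=
  iprod (chi (n := n)) ω = 0 ∧ botOp ω = 0

/-- The projection `p(α) = α - c ∧ (χ ⌟ α)` onto forms annihilated by `χ ⌟ ·`. -/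
def proj {n : ℕ} : ∀ {k : ℕ}, Form (2 * n + 1) k → Form (2 * n + 1) k
  | 0, α => α
  | j + 1, α => α - reindex (Nat.add_comm 1 j) (wedge contact (iprod (chi (n := n)) α))

/-- The projected exterior derivative `d_p = p ∘ d`. -/
def dproj {n k : ℕ} (ω : Form (2 * n + 1) k) : Form (2 * n + 1) (k + 1) := proj (exd ω)

/-- Lie derivative along the (constant) Reeb field `χ`. -/
def lieChi {n k : ℕ} (ω : Form (2 * n + 1) k) : Form (2 * n + 1) k := fun x v =>
  fderiv ℝ (fun y => ω y v) x (chi (n := n))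

/-- The Euler operator `E = d_p ∘ ⊥ ∘ d_p + L_χ` on n-forms over J¹ℝⁿ. -/
def euler : ∀ {n : ℕ}, Form (2 * n + 1) n → Form (2 * n + 1) n
  | 0, ω => lieChi ω
  | n + 1, ω =>
    reindex (show n + 1 + 1 - 2 + 1 = n + 1 by omega) (dproj (botOp (dproj ω))) + lieChi ω

/-- The horizontal volume form `β = dq¹ ∧ … ∧ dqⁿ` on J¹ℝⁿ. -/
def qvol {n : ℕ} : Form (2 * n + 1) n := fun _ v =>
  Matrix.det (Matrix.of fun i j : Fin n => v i (qIdx j))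

/-- The volume form `β = dq¹ ∧ … ∧ dqⁿ` on the base ℝⁿ. -/
def baseVol {n : ℕ} : Form n n := fun _ v => Matrix.det (Matrix.of fun i j : Fin n => v i j)

/-- `β_μ = ∂_{q^μ} ⌟ β`. -/
def betaMu {n : ℕ} (μ : Fin n) : Form (2 * n + 1) (n - 1) := iprod (basisVec (qIdx μ)) qvol

/-- The first jet prolongation `j¹φ : ℝⁿ → ℝ^{2n+1}`, `x ↦ (x, φ(x), ∂₁φ(x), …, ∂ₙφ(x))`. -/
def jet {n : ℕ} (φ : Vec n → ℝ) (x : Vec n) : Vec (2 * n + 1) := fun i =>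
  if h : (i : ℕ) < n then x ⟨i, h⟩
  else if h2 : (i : ℕ) = n then φ x
  else fderiv ℝ φ x (basisVec ⟨(i : ℕ) - (n + 1), by have := i.isLt; omega⟩)

/-- Second partial derivative `φ_{μν} = ∂²φ/∂q^μ∂q^ν`. -/
def d2 {n : ℕ} (φ : Vec n → ℝ) (μ ν : Fin n) : Vec n → ℝ := fun x =>
  fderiv ℝ (fun y => fderiv ℝ φ y (basisVec ν)) x (basisVec μ)

/-- A form is multisymplectic if it is closed and pointwise nondegenerate. -/
def Multisymplectic {m k : ℕ} (μ : Form m k) : Prop :=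
  exd μ = 0 ∧ ∀ (x v : Vec m), iprod v μ x = 0 → v = 0

/-- Lift a form on J¹ℝⁿ = ℝ^{2n+1} to ℝ^{2n+2} = J¹ℝⁿ × ℝ (extra coordinate `e`)
along the projection. -/
def liftForm {n k : ℕ} (ω : Form (2 * n + 1) k) : Form (2 * n + 1 + 1) k :=
  pullback (fun y (i : Fin (2 * n + 1)) => y i.castSucc) ω

/-- The 1-form `de` on ℝ^{2n+2}. -/
def deForm {n : ℕ} : Form (2 * n + 1 + 1) 1 := dx (Fin.last (2 * n + 1))

/-- The (n+1)-form `m_ω = de ∧ β + c ∧ ω` on ℝ^{2n+2}. -/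
def msf {n : ℕ} (ω : Form (2 * n + 1) n) : Form (2 * n + 1 + 1) (n + 1) :=
  reindex (Nat.add_comm 1 n) (wedge (deForm (n := n)) (liftForm qvol)) +
    reindex (Nat.add_comm 1 n) (wedge (liftForm (contact (n := n))) (liftForm ω))

/-- Wedge of four coordinate 1-forms on ℝ⁹ = J¹ℝ⁴. -/
def dd (i j k l : Fin (2 * 4 + 1)) : Form (2 * 4 + 1) 4 :=
  wedge (wedge (wedge (dx i) (dx j)) (dx k)) (dx l)

/-- The effective 4-form on ℝ⁹ representing the second heavenly equation of Plebański. -/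
def omegaP2 : Form (2 * 4 + 1) 4 :=
  (1 / 2 : ℝ) • (dd (qIdx 0) (qIdx 1) (qIdx 2) (pIdx 1) -
      dd (qIdx 0) (qIdx 1) (qIdx 3) (pIdx 0) -
      dd (qIdx 1) (qIdx 2) (qIdx 3) (pIdx 2) +
      dd (qIdx 0) (qIdx 2) (qIdx 3) (pIdx 3)) +
    dd (qIdx 2) (qIdx 3) (pIdx 0) (pIdx 1)

/-- A tangent vector is vertical if all its `q`-components vanish. -/
def Vertical {n : ℕ} (v : Vec (2 * n + 1)) : Prop := ∀ j : Fin n, v (qIdx j) = 0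

/-- `ω` vanishes whenever one of its arguments is vertical. -/
def VanishesOnVertical {n k : ℕ} (ω : Form (2 * n + 1) k) : Prop :=
  ∀ x w i, Vertical (w i) → ω x w = 0

/-- `ω` vanishes whenever two of its arguments are vertical. -/
def VanishesOnVerticalPair {n k : ℕ} (ω : Form (2 * n + 1) k) : Prop :=
  ∀ x w i j, i ≠ j → Vertical (w i) → Vertical (w j) → ω x w = 0

lemma vertical_chi {n : ℕ} : Vertical (chi (n := n)) := fun j => by
  have h : qIdx j ≠ uIdx := by
    have := j.isLt
    simp only [ne_eq, Fin.ext_iff, qIdx, uIdx]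
    omega
  simp [chi, basisVec, h]

lemma vertical_pIdx {n : ℕ} (μ : Fin n) : Vertical (basisVec (pIdx μ)) := fun j => by
  have h : qIdx j ≠ pIdx μ := by
    have := j.isLt
    simp only [ne_eq, Fin.ext_iff, qIdx, pIdx]
    omega
  simp [basisVec, h]

lemma vanishesOnVertical_fsmul_qvol {n : ℕ} (L : Vec (2 * n + 1) → ℝ) :
    VanishesOnVertical (fsmul L qvol) := fun x w i hi => by
  have h : qvol x w = 0 := Matrix.det_eq_zero_of_row_eq_zero i fun j => hi j
  simp [fsmul, h]

lemma VanishesOnVertical.exd {n k : ℕ} {ω : Form (2 * n + 1) k} (h : VanishesOnVertical ω) :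
    VanishesOnVerticalPair (exd ω) := fun x w i j hij hi hj => by
  refine Finset.sum_eq_zero fun l _ => ?_
  obtain ⟨a, hla, ha⟩ : ∃ a, a ≠ l ∧ Vertical (w a) := by
    by_cases hl : i = l
    · exact ⟨j, fun e => hij (hl.trans e.symm), hj⟩
    · exact ⟨i, hl, hi⟩
  obtain ⟨b, rfl⟩ := Fin.exists_succAbove_eq hla
  have h0 : (fun y => ω y fun j => w (l.succAbove j)) = fun _ => (0 : ℝ) :=
    funext fun y => h y _ b ha
  simp [h0]

lemma VanishesOnVerticalPair.iprod {n k : ℕ} {ω : Form (2 * n + 1) (k + 1)}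
    (h : VanishesOnVerticalPair ω) {v : Vec (2 * n + 1)} (hv : Vertical v) :
    VanishesOnVertical (k := k) (iprod v ω) := fun x w i hi =>
  h x (Fin.cons v w) 0 i.succ (Fin.succ_ne_zero i).symm (by simpa using hv) (by simpa using hi)

lemma VanishesOnVerticalPair.proj {n k : ℕ} {ω : Form (2 * n + 1) (k + 1)}
    (h : VanishesOnVerticalPair ω) : VanishesOnVerticalPair (proj ω) := fun x w i j hij hi hj => by
  have key : ∀ w' : Fin (1 + k) → Vec (2 * n + 1), ∀ i j, i ≠ j → Vertical (w' i) →
      Vertical (w' j) → wedge contact (MA.iprod (chi (n := n)) ω) x w' = 0 := by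
    intro w' i j hij hi hj
    refine mul_eq_zero_of_right _ (Finset.sum_eq_zero fun σ _ => mul_eq_zero_of_right _ ?_)
    obtain ⟨a, ha0, ha⟩ : ∃ a, a ≠ σ (Fin.castAdd k 0) ∧ Vertical (w' a) := by
      by_cases hl : i = σ (Fin.castAdd k 0)
      · exact ⟨j, fun e => hij (hl.trans e.symm), hj⟩
      · exact ⟨i, hl, hi⟩
    obtain ⟨b, rfl⟩ := σ.surjective a
    induction b using Fin.addCases with
    | left b => exact absurd (congrArg (fun t => σ (Fin.castAdd k t)) (Subsingleton.elim b 0)) ha0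
    | right b => exact h.iprod vertical_chi _ _ b ha
  have h' := key (fun a => w (Fin.cast (Nat.add_comm 1 k) a)) (Fin.cast (Nat.add_comm k 1) i)
    (Fin.cast (Nat.add_comm k 1) j) (by simpa [Fin.ext_iff] using hij) (by simpa using hi)
    (by simpa using hj)
  change ω x w - _ = 0
  rw [h x w i j hij hi hj, zero_sub, neg_eq_zero]
  exact h'

lemma VanishesOnVerticalPair.botOp {n k : ℕ} {ω : Form (2 * n + 1) (k + 2)}
    (h : VanishesOnVerticalPair ω) : VanishesOnVertical (k := k) (botOp ω) := fun x w i hi => by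
  have h0 : ∀ μ : Fin n,
      MA.iprod (basisVec (pIdx μ)) (MA.iprod (basisVec (qIdx μ)) ω) x w = 0 := fun μ =>
    h x (Fin.cons (basisVec (qIdx μ)) (Fin.cons (basisVec (pIdx μ)) w : Fin (k + 1) → _))
      1 i.succ.succ (by simp [Fin.ext_iff]) (vertical_pIdx μ) hi
  change (∑ μ : Fin n, MA.iprod (basisVec (pIdx μ)) (MA.iprod (basisVec (qIdx μ)) ω)) x w = 0
  rw [Finset.sum_apply, Finset.sum_apply]
  exact Finset.sum_eq_zero fun μ _ => h0 μ

/-- The Euler form of a first-order Lagrangian is of degree at most one in the vertical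
directions. -/
lemma vanishesOnVerticalPair_euler_fsmul_qvol {n : ℕ} (L : Vec (2 * (n + 2) + 1) → ℝ) :
    VanishesOnVerticalPair (euler (fsmul L (qvol (n := n + 2)))) := fun x w i j hij hi hj => by
  have h1 : VanishesOnVerticalPair (dproj (fsmul L (qvol (n := n + 2)))) :=
    (vanishesOnVertical_fsmul_qvol L).exd.proj
  have h2 : VanishesOnVerticalPair (dproj (botOp (dproj (fsmul L (qvol (n := n + 2)))))) :=
    h1.botOp.exd.proj
  have h3 : lieChi (fsmul L (qvol (n := n + 2))) x w = 0 := by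
    have h0 : (fun y => fsmul L (qvol (n := n + 2)) y w) = fun _ => (0 : ℝ) :=
      funext fun y => vanishesOnVertical_fsmul_qvol L y w i hi
    simp [lieChi, h0]
  change _ + lieChi (fsmul L (qvol (n := n + 2))) x w = 0
  rw [h3, add_zero]
  exact h2 x w i j hij hi hj

/-- Wedging a product of coordinate `1`-forms, written as a minor, with one more. -/
lemma wedge_det_dx {m k : ℕ} (I : Fin (k + 1) → Fin m) :
    wedge (fun _ w => Matrix.det (Matrix.of fun a b => w a (I (Fin.castAdd 1 b))))
      (dx (I (Fin.natAdd k 0))) =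
    fun _ v => Matrix.det (Matrix.of fun a b => v a (I b)) := by
  funext x v
  let e : Fin k ↪ Fin (k + 1) := ⟨Fin.castAdd 1, Fin.castAdd_injective k 1⟩
  have he : ∀ (τ : Equiv.Perm (Fin k)) i,
      τ.viaFintypeEmbedding e (Fin.castAdd 1 i) = Fin.castAdd 1 (τ i) := fun τ i =>
    τ.viaFintypeEmbedding_apply_image e i
  have hl : ∀ τ : Equiv.Perm (Fin k),
      τ.viaFintypeEmbedding e (Fin.natAdd k 0) = Fin.natAdd k 0 := fun τ => by
    refine τ.viaFintypeEmbedding_apply_notMem_range e ?_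
    rintro ⟨a, ha⟩
    have := congrArg Fin.val ha
    have := a.isLt
    simp [e] at *
    omega
  let F : Equiv.Perm (Fin (k + 1)) → ℝ := fun σ =>
    ((Equiv.Perm.sign σ : ℤ) : ℝ) * ∏ b, v (σ b) (I b)
  have key : ∀ σ : Equiv.Perm (Fin (k + 1)),
      ((Equiv.Perm.sign σ : ℤ) : ℝ) *
        Matrix.det (Matrix.of fun a b => v (σ (Fin.castAdd 1 a)) (I (Fin.castAdd 1 b))) *
        dx (I (Fin.natAdd k 0)) x (fun j => v (σ (Fin.natAdd k j))) =
      ∑ τ : Equiv.Perm (Fin k), F (σ * τ.viaFintypeEmbedding e) := by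
    intro σ
    rw [Matrix.det_apply', Finset.mul_sum, Finset.sum_mul]
    refine Finset.sum_congr rfl fun τ _ => ?_
    simp only [F, Fin.prod_univ_add, Equiv.Perm.mul_apply, he, Equiv.Perm.sign_mul,
      Equiv.Perm.viaFintypeEmbedding_sign, dx, Matrix.of_apply, Finset.univ_unique,
      Finset.prod_singleton, Fin.default_eq_zero, hl]
    push_cast
    ring
  have hsum : ∀ τ : Equiv.Perm (Fin k),
      ∑ σ, F (σ * τ.viaFintypeEmbedding e) = ∑ σ, F σ := fun τ =>
    Equiv.sum_comp (Equiv.mulRight (τ.viaFintypeEmbedding e)) F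
  have hk : (k.factorial : ℝ) ≠ 0 := by exact_mod_cast k.factorial_ne_zero
  rw [wedge, Finset.sum_congr rfl fun σ _ => key σ, Finset.sum_comm,
    Finset.sum_congr rfl fun τ _ => hsum τ, Matrix.det_apply']
  simp [F, Fintype.card_perm, hk]

lemma dx_eq_det {m : ℕ} (i : Fin m) :
    dx i = fun _ v => Matrix.det (Matrix.of fun a (_ : Fin 1) => v a i) := by
  funext x v
  simp [dx]

lemma dd_eq_det (i j k l : Fin (2 * 4 + 1)) :
    dd i j k l = fun _ v => Matrix.det (Matrix.of fun a b => v a (![i, j, k, l] b)) := by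
  have h1 : dx i = fun _ v =>
      Matrix.det (Matrix.of fun a (b : Fin 1) => v a (![i, j] (Fin.castAdd 1 b))) := by
    rw [dx_eq_det]
    funext x v
    simp
  have h2 : wedge (dx i) (dx j) = fun _ v =>
      Matrix.det (Matrix.of fun a (b : Fin 2) => v a (![i, j, k] (Fin.castAdd 1 b))) := by
    rw [h1]
    refine (wedge_det_dx ![i, j]).trans ?_
    congr! 7 with x v a b
    fin_cases b <;> rfl
  have h3 : wedge (wedge (dx i) (dx j)) (dx k) = fun _ v =>
      Matrix.det (Matrix.of fun a (b : Fin 3) => v a (![i, j, k, l] (Fin.castAdd 1 b))) := by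
    rw [h2]
    refine (wedge_det_dx ![i, j, k]).trans ?_
    congr! 7 with x v a b
    fin_cases b <;> rfl
  rw [dd, h3]
  exact wedge_det_dx ![i, j, k, l]

lemma det_fin_four (A : Matrix (Fin 4) (Fin 4) ℝ) :
    A.det =
      A 0 0 * (A 1 1 * (A 2 2 * A 3 3 - A 2 3 * A 3 2) - A 1 2 * (A 2 1 * A 3 3 - A 2 3 * A 3 1) +
        A 1 3 * (A 2 1 * A 3 2 - A 2 2 * A 3 1)) -
      A 0 1 * (A 1 0 * (A 2 2 * A 3 3 - A 2 3 * A 3 2) - A 1 2 * (A 2 0 * A 3 3 - A 2 3 * A 3 0) +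
        A 1 3 * (A 2 0 * A 3 2 - A 2 2 * A 3 0)) +
      A 0 2 * (A 1 0 * (A 2 1 * A 3 3 - A 2 3 * A 3 1) - A 1 1 * (A 2 0 * A 3 3 - A 2 3 * A 3 0) +
        A 1 3 * (A 2 0 * A 3 1 - A 2 1 * A 3 0)) -
      A 0 3 * (A 1 0 * (A 2 1 * A 3 2 - A 2 2 * A 3 1) - A 1 1 * (A 2 0 * A 3 2 - A 2 2 * A 3 0) +
        A 1 2 * (A 2 0 * A 3 1 - A 2 1 * A 3 0)) := by
  have h : ∀ i : Fin 4, ∀ j : Fin 3, i.succAbove j =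
      ![![1, 2, 3], ![0, 2, 3], ![0, 1, 3], ![0, 1, 2]] i j := by decide
  have h1 : Fin.succ (0 : Fin 3) = 1 := rfl
  have h2 : Fin.succ (1 : Fin 3) = 2 := rfl
  have h3 : Fin.succ (2 : Fin 3) = 3 := rfl
  simp only [Matrix.det_succ_row_zero (n := 3), Fin.sum_univ_four, Matrix.det_fin_three,
    Matrix.submatrix_apply, h, h1, h2, h3]
  simp
  ring

lemma omegaP2_apply (x : Vec (2 * 4 + 1)) (v : Fin 4 → Vec (2 * 4 + 1)) :
    omegaP2 x v = 1 / 2 *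
      (Matrix.det (Matrix.of fun a b => v a (![0, 1, 2, 6] b)) -
        Matrix.det (Matrix.of fun a b => v a (![0, 1, 3, 5] b)) -
        Matrix.det (Matrix.of fun a b => v a (![1, 2, 3, 7] b)) +
        Matrix.det (Matrix.of fun a b => v a (![0, 2, 3, 8] b))) +
      Matrix.det (Matrix.of fun a b => v a (![2, 3, 5, 6] b)) := by
  simp only [omegaP2, dd_eq_det]
  rfl

lemma effective_omegaP2 : Effective omegaP2 := by
  constructor
  · funext x w
    have h : ∀ I : Fin 4 → Fin (2 * 4 + 1), (∀ b, I b ≠ 4) →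
        Matrix.det (Matrix.of fun a b =>
          (Fin.cons (chi (n := 4)) w : Fin 4 → Vec (2 * 4 + 1)) a (I b)) = 0 := fun I hI => by
      refine Matrix.det_eq_zero_of_row_eq_zero 0 fun b => ?_
      have : I b ≠ uIdx := hI b
      simp [chi, basisVec, this]
    change omegaP2 x (Fin.cons (chi (n := 4)) w : Fin 4 → Vec (2 * 4 + 1)) = 0
    rw [omegaP2_apply, h _ (by decide), h _ (by decide), h _ (by decide), h _ (by decide),
      h _ (by decide)]
    norm_num
  · funext x w
    change (∑ μ : Fin 4, iprod (basisVec (pIdx μ)) (iprod (basisVec (qIdx μ)) omegaP2)) x w = 0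
    rw [Finset.sum_apply, Finset.sum_apply]
    change ∑ μ : Fin 4, omegaP2 x (Fin.cons (basisVec (qIdx μ))
      (Fin.cons (basisVec (pIdx μ)) w : Fin 3 → Vec (2 * 4 + 1)) : Fin 4 → Vec (2 * 4 + 1)) = 0
    have h0 : ∀ u v : Vec (2 * 4 + 1),
        (Fin.cons u (Fin.cons v w : Fin 3 → Vec (2 * 4 + 1)) : Fin 4 → Vec (2 * 4 + 1)) =
          ![u, v, w 0, w 1] := fun u v => by
      funext a
      fin_cases a <;> rfl
    have hq : ∀ μ : Fin 4, qIdx μ = ![0, 1, 2, 3] μ := by decide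
    have hp : ∀ μ : Fin 4, pIdx μ = ![5, 6, 7, 8] μ := by decide
    simp only [h0, omegaP2_apply, Fin.sum_univ_four, det_fin_four, hq, hp, basisVec]
    simp [Pi.single_apply]
    ring

lemma fderiv_jet {φ : Vec 4 → ℝ} (hφ : ContDiff ℝ (⊤ : ℕ∞) φ) (x v : Vec 4) :
    (∀ μ : Fin 4, fderiv ℝ (jet φ) x v (qIdx μ) = v μ) ∧
      ∀ μ : Fin 4, fderiv ℝ (jet φ) x v (pIdx μ) = ∑ ν, v ν * d2 φ ν μ x := by
  have hd : ContDiff ℝ 1 (fderiv ℝ φ) := hφ.fderiv_right (WithTop.coe_le_coe.2 le_top)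
  have hp : ∀ u, Differentiable ℝ fun y => fderiv ℝ φ y u := fun u =>
    (hd.clm_apply contDiff_const).differentiable (by norm_num)
  have hq : ∀ (μ : Fin 4), (fun y => jet φ y (qIdx μ)) = fun y => y μ := fun μ => by
    funext y
    simp [jet, qIdx]
  have hpj : ∀ (μ : Fin 4),
      (fun y => jet φ y (pIdx μ)) = fun y => fderiv ℝ φ y (basisVec μ) := fun μ => by
    funext y
    have h1 : ¬ (4 + 1 + (μ : ℕ) < 4) := by omega
    have h2 : ¬ (4 + 1 + (μ : ℕ) = 4) := by omega
    simp [jet, pIdx, h1, h2]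
  have hdiff : ∀ i, DifferentiableAt ℝ (fun y => jet φ y i) x := fun i => by
    unfold jet
    split_ifs
    · fun_prop
    · exact hφ.differentiable (by simp) x
    · exact hp _ x
  have hcomp : ∀ i, fderiv ℝ (jet φ) x v i = fderiv ℝ (fun y => jet φ y i) x v := fun i => by
    have : fderiv ℝ (jet φ) x = ContinuousLinearMap.pi fun i => fderiv ℝ (fun y => jet φ y i) x :=
      fderiv_pi hdiff
    rw [this]
    rfl
  refine ⟨fun μ => ?_, fun μ => ?_⟩
  · rw [hcomp, hq, (hasFDerivAt_apply μ x).fderiv]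
    rfl
  · rw [hcomp, hpj]
    conv_lhs => rw [← Finset.univ_sum_single v]
    rw [map_sum]
    refine Finset.sum_congr rfl fun ν _ => ?_
    have : (Pi.single ν (v ν) : Vec 4) = v ν • basisVec ν := by
      simp [basisVec, ← Pi.single_smul]
    rw [this, map_smul, smul_eq_mul, d2]

lemma d2_comm {φ : Vec 4 → ℝ} (hφ : ContDiff ℝ (⊤ : ℕ∞) φ) (μ ν : Fin 4) (x : Vec 4) :
    d2 φ μ ν x = d2 φ ν μ x := by
  have hd : Differentiable ℝ (fderiv ℝ φ) :=
    (hφ.fderiv_right (m := 1) (WithTop.coe_le_coe.2 le_top)).differentiable (by norm_num)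
  have h : ∀ a b : Fin 4, d2 φ a b x = fderiv ℝ (fderiv ℝ φ) x (basisVec a) (basisVec b) :=
    fun a b => by
      rw [d2, fderiv_clm_apply (hd x) (differentiableAt_const _)]
      simp
  rw [h, h]
  exact (hφ.contDiffAt.isSymmSndFDerivAt
    (by simpa using WithTop.coe_le_coe.2 (le_top : (2 : ℕ∞) ≤ ⊤))).eq _ _

lemma pullback_jet_omegaP2 {φ : Vec 4 → ℝ} (hφ : ContDiff ℝ (⊤ : ℕ∞) φ) :
    pullback (jet φ) omegaP2 =
      fsmul (fun x => d2 φ 0 0 x * d2 φ 1 1 x - (d2 φ 0 1 x) ^ 2 +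
        d2 φ 0 2 x + d2 φ 1 3 x) baseVol := by
  funext x v
  have hdet : ∀ (I : Fin 4 → Fin (2 * 4 + 1)) (N : Matrix (Fin 4) (Fin 4) ℝ),
      (∀ a b, fderiv ℝ (jet φ) x (v a) (I b) = ∑ ν, v a ν * N ν b) →
      Matrix.det (Matrix.of fun a b => fderiv ℝ (jet φ) x (v a) (I b)) =
        baseVol x v * N.det := fun I N h => by
    rw [baseVol, ← Matrix.det_mul]
    congr 1
    ext a b
    simp [h, Matrix.mul_apply]
  have hq : ∀ (a μ : Fin 4),
      fderiv ℝ (jet φ) x (v a) (qIdx μ) = ∑ ν, v a ν * (Pi.single μ 1 : Vec 4) ν := fun a μ => by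
    simp [(fderiv_jet hφ x (v a)).1, Pi.single_apply]
  have hp := fun a : Fin 4 => (fderiv_jet hφ x (v a)).2
  let H : Fin 4 → Vec 4 := fun μ ν => d2 φ ν μ x
  let e : Fin 4 → Vec 4 := fun μ => Pi.single μ 1
  have h1 := hdet ![0, 1, 2, 6] (Matrix.of fun ν b => ![e 0, e 1, e 2, H 1] b ν) fun a b => by
    fin_cases b
    exacts [hq a 0, hq a 1, hq a 2, hp a 1]
  have h2 := hdet ![0, 1, 3, 5] (Matrix.of fun ν b => ![e 0, e 1, e 3, H 0] b ν) fun a b => by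
    fin_cases b
    exacts [hq a 0, hq a 1, hq a 3, hp a 0]
  have h3 := hdet ![1, 2, 3, 7] (Matrix.of fun ν b => ![e 1, e 2, e 3, H 2] b ν) fun a b => by
    fin_cases b
    exacts [hq a 1, hq a 2, hq a 3, hp a 2]
  have h4 := hdet ![0, 2, 3, 8] (Matrix.of fun ν b => ![e 0, e 2, e 3, H 3] b ν) fun a b => by
    fin_cases b
    exacts [hq a 0, hq a 2, hq a 3, hp a 3]
  have h5 := hdet ![2, 3, 5, 6] (Matrix.of fun ν b => ![e 2, e 3, H 0, H 1] b ν) fun a b => by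
    fin_cases b
    exacts [hq a 2, hq a 3, hp a 0, hp a 1]
  rw [pullback, omegaP2_apply, h1, h2, h3, h4, h5, fsmul]
  simp [det_fin_four, e, H, Pi.single_apply, d2_comm hφ 1 0, d2_comm hφ 2 0, d2_comm hφ 3 1]
  ring

/-- The term `dq³ ∧ dq⁴ ∧ dp₁ ∧ dp₂` is detected by the corresponding coordinate vectors. -/
lemma omegaP2_basisVec (x : Vec (2 * 4 + 1)) :
    omegaP2 x ![basisVec (qIdx 2), basisVec (qIdx 3), basisVec (pIdx 0), basisVec (pIdx 1)] =
      1 := by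
  simp [omegaP2_apply, det_fin_four, basisVec, qIdx, pIdx, Pi.single_apply, Fin.ext_iff]

/-- the displayed effective 4-form represents the second heavenly equation
of Plebański `φ₁₁φ₂₂ − (φ₁₂)² + φ₁₃ + φ₂₄ = 0`, and this equation is not the
Euler–Lagrange equation of any first-order Lagrangian. -/
theorem plebanski_second_heavenly_not_variational :
    (Effective omegaP2 ∧
      ∀ φ : Vec 4 → ℝ, ContDiff ℝ (⊤ : ℕ∞) φ →
        pullback (jet φ) omegaP2 =
          fsmul (fun x => d2 φ 0 0 x * d2 φ 1 1 x - (d2 φ 0 1 x) ^ 2 +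
            d2 φ 0 2 x + d2 φ 1 3 x) baseVol) ∧
    ¬ ∃ (L k : Vec (2 * 4 + 1) → ℝ), ContDiff ℝ (⊤ : ℕ∞) L ∧ ContDiff ℝ (⊤ : ℕ∞) k ∧ (∀ x, k x ≠ 0) ∧
        fsmul k omegaP2 = euler (fsmul L qvol) := by
  refine ⟨⟨effective_omegaP2, fun φ hφ => pullback_jet_omegaP2 hφ⟩, ?_⟩
  rintro ⟨L, k, -, -, hk, h⟩
  have h0 := congrFun (congrFun h 0)
    ![basisVec (qIdx 2), basisVec (qIdx 3), basisVec (pIdx 0), basisVec (pIdx 1)]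
  rw [vanishesOnVerticalPair_euler_fsmul_qvol (n := 2) L _ _ 2 3 (by decide) (vertical_pIdx 0)
    (vertical_pIdx 1), fsmul, omegaP2_basisVec, mul_one] at h0
  exact hk 0 h0

end MA
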